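/- Let n = 3k with k ≥ 1. Then row n of the hyperbolic Pascal triangle {4,5} has an odd number s_n of vertices, and its central vertex (the vertex at position (s_n − 1)/2, 0-indexed) has type B and value 2^k. -/

import Mathlib

/-- Type of a vertex in a hyperbolic Pascal triangle: winger, A, or B. -/
inductive HVType where
  | W : HVType
  | A : HVType
  | B : HVType
deriving DecidableEq, Repr

/-- Number of type-B children produced by a vertex of the given type
in the hyperbolic Pascal triangle `{4,q}`. -/
def hBCount (q : ℕ) : HVType → ℕ
  | .A => q - 4
  | .B => q - 3
  | .W => 0

/-- The inner part of the next row: for each pair of consecutive vertices a shared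
type-A child whose value is the sum of the parents' values, followed by the
type-B copies of the right parent. -/
def hMid (q : ℕ) : List (HVType × ℕ) → List (HVType × ℕ)
  | a :: b :: rest =>
      (HVType.A, a.2 + b.2) ::
        (List.replicate (hBCount q b.1) (HVType.B, b.2) ++ hMid q (b :: rest))
  | _ => []

/-- Row `n` of the hyperbolic Pascal triangle `{4,q}`, as a list of
(type, value) pairs read from left to right. -/
def hRow (q : ℕ) : ℕ → List (HVType × ℕ)
  | 0 => [(HVType.W, 1)]
  | n + 1 => (HVType.W, 1) :: (hMid q (hRow q n) ++ [(HVType.W, 1)])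

/-- Number of type-A vertices of row `n`. -/
def hCountA (q n : ℕ) : ℕ := ((hRow q n).filter (fun v => v.1 = HVType.A)).length

/-- Number of type-B vertices of row `n`. -/
def hCountB (q n : ℕ) : ℕ := ((hRow q n).filter (fun v => v.1 = HVType.B)).length

/-- Sum of the values of the type-A vertices of row `n`. -/
def hSumA (q n : ℕ) : ℕ :=
  (((hRow q n).filter (fun v => v.1 = HVType.A)).map Prod.snd).sum

/-- Sum of the values of the type-B vertices of row `n`. -/
def hSumB (q n : ℕ) : ℕ :=
  (((hRow q n).filter (fun v => v.1 = HVType.B)).map Prod.snd).sum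

/-- The number `s_n` of vertices of row `n`. -/
def hLen (q n : ℕ) : ℕ := (hRow q n).length

/-- The value of the `k`-th (0-indexed) vertex of row `n`. -/
def hVal (q n k : ℕ) : ℕ := ((hRow q n).getD k (HVType.W, 0)).2

/-- The type of the `k`-th (0-indexed) vertex of row `n`. -/
def hType (q n k : ℕ) : HVType := ((hRow q n).getD k (HVType.W, 0)).1

/-- The children of the vertices of a segment of a row: the type-B children of each vertex, and
between them the type-A child of each pair of consecutive vertices. -/
def hChildren (q : ℕ) : List (HVType × ℕ) → List (HVType × ℕ)
  | [] => []
  | [a] => List.replicate (hBCount q a.1) (HVType.B, a.2)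
  | a :: b :: r =>
      List.replicate (hBCount q a.1) (HVType.B, a.2) ++
        (HVType.A, a.2 + b.2) :: hChildren q (b :: r)

theorem hChildren_cons (q : ℕ) (a : HVType × ℕ) (l : List (HVType × ℕ)) :
    hChildren q (a :: l) =
      List.replicate (hBCount q a.1) (HVType.B, a.2) ++ hMid q (a :: l) := by
  induction l generalizing a with
  | nil => simp [hChildren, hMid]
  | cons b l ih => simp [hChildren, hMid, ih]

theorem hChildren_append (q : ℕ) (l : List (HVType × ℕ)) (a b : HVType × ℕ)
    (r : List (HVType × ℕ)) :
    hChildren q (l ++ a :: b :: r) =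
      hChildren q (l ++ [a]) ++ (HVType.A, a.2 + b.2) :: hChildren q (b :: r) := by
  induction l with
  | nil => simp [hChildren]
  | cons c l ih =>
    cases l with
    | nil => simp [hChildren]
    | cons d l => simpa [hChildren] using ih

theorem hChildren_reverse (q : ℕ) (l : List (HVType × ℕ)) :
    hChildren q l.reverse = (hChildren q l).reverse := by
  induction l with
  | nil => simp [hChildren]
  | cons a l ih =>
    cases l with
    | nil => simp [hChildren]
    | cons b l =>
      simp only [List.reverse_cons] at ih
      simp [hChildren, hChildren_append, ih, add_comm]

/-- The children of a central segment `x :: m` of a symmetric row, whose end vertices have equal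
values, form a central segment of the next row, which is again symmetric about it. -/
theorem hRow_succ_of_central (q n : ℕ) (l m m' : List (HVType × ℕ)) (x y : HVType × ℕ)
    (hm : x :: m = m' ++ [y]) (hxy : y.2 = x.2)
    (h : hRow q n = (HVType.W, 1) :: l ++ (x :: m) ++ ((HVType.W, 1) :: l).reverse) :
    ∃ l', hRow q (n + 1) =
      (HVType.W, 1) :: l' ++ hChildren q (x :: m) ++ ((HVType.W, 1) :: l').reverse := by
  have hrow : hMid q (hRow q n) = hChildren q (hRow q n) := by
    rw [h]
    simp [hChildren_cons, hBCount]
  obtain ⟨p, a, hp⟩ : ∃ p a, (HVType.W, 1) :: l = p ++ [a] :=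
    ⟨_, _, (List.dropLast_append_getLast (List.cons_ne_nil _ _)).symm⟩
  refine ⟨hChildren q (p ++ [a]) ++ [(HVType.A, a.2 + x.2)], ?_⟩
  have hr : hChildren q (a :: p.reverse) = (hChildren q (p ++ [a])).reverse := by
    rw [← hChildren_reverse]
    simp
  have hright : hChildren q (x :: m ++ a :: p.reverse) =
      hChildren q (x :: m) ++ (HVType.A, a.2 + x.2) :: (hChildren q (p ++ [a])).reverse := by
    rw [hm, List.append_assoc, List.singleton_append, hChildren_append, hr, hxy, add_comm]
  have hall : hChildren q (hRow q n) = hChildren q (p ++ [a]) ++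
      (HVType.A, a.2 + x.2) :: hChildren q (x :: m ++ a :: p.reverse) := by
    rw [h, hp, List.cons_append, ← hChildren_append]
    simp
  rw [hRow, hrow, hall, hright]
  simp

theorem hRow_five_three_mul_succ (k : ℕ) :
    ∃ l, hRow 5 (3 * (k + 1)) = (HVType.W, 1) :: l ++ [(HVType.B, 2 ^ (k + 1))] ++
      ((HVType.W, 1) :: l).reverse := by
  induction k with
  | zero => exact ⟨[(HVType.A, 3)], by decide⟩
  | succ k ih =>
    obtain ⟨l₀, h₀⟩ := ih
    set v := 2 ^ (k + 1) with hv
    obtain ⟨l₁, h₁⟩ := hRow_succ_of_central 5 _ l₀ [] [] _ _ rfl rfl h₀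
    obtain ⟨l₂, h₂⟩ := hRow_succ_of_central 5 _ l₁ [(HVType.B, v)] [(HVType.B, v)]
      (HVType.B, v) (HVType.B, v) rfl rfl h₁
    obtain ⟨l₃, h₃⟩ := hRow_succ_of_central 5 _ (l₂ ++ [(HVType.B, v), (HVType.B, v)]) [] []
      (HVType.A, v + v) _ rfl rfl (by rw [h₂]; simp [hChildren, hBCount, List.replicate])
    refine ⟨l₃, ?_⟩
    rw [pow_succ, ← hv, mul_two]
    exact h₃

/-- for `n = 3k` with `k ≥ 1`, row `n` of the hyperbolic Pascal
triangle `{4,5}` has an odd number of vertices, and its central vertex has type B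
and value `2^k`. -/
theorem stmt_12 (k : ℕ) (hk : 1 ≤ k) :
    Odd (hLen 5 (3 * k)) ∧
    hType 5 (3 * k) ((hLen 5 (3 * k) - 1) / 2) = HVType.B ∧
    hVal 5 (3 * k) ((hLen 5 (3 * k) - 1) / 2) = 2 ^ k := by
  obtain ⟨j, rfl⟩ : ∃ j, k = j + 1 := ⟨k - 1, by omega⟩
  obtain ⟨l, hl⟩ := hRow_five_three_mul_succ j
  have hlen : hLen 5 (3 * (j + 1)) = 2 * ((HVType.W, 1) :: l).length + 1 := by
    rw [hLen, hl]
    simp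
    ring
  have hget : (hRow 5 (3 * (j + 1))).getD ((HVType.W, 1) :: l).length (HVType.W, 0) =
      (HVType.B, 2 ^ (j + 1)) := by
    rw [hl, List.append_assoc, List.getD_append_right _ _ _ _ le_rfl]
    simp
  have hmid : (hLen 5 (3 * (j + 1)) - 1) / 2 = ((HVType.W, 1) :: l).length := by
    omega
  rw [hmid, hType, hVal, hget]
  exact ⟨⟨_, hlen⟩, rfl, rfl⟩
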